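/- Let M ≥ 1, r ∈ {1,…,M}, 0 < ρ ≤ 1, and let ε > 0 satisfy r/ε ≥ 1. Then there exists a finite set S of M×M real matrices with cardinality at most (9r/ε)^{4Mr} such that every Q ∈ M(ρ,r) is within Frobenius distance ε of some element of S; that is, the covering number of M(ρ,r) with respect to the Frobenius norm satisfies N(ε, M(ρ,r)) ≤ (9r/ε)^{4Mr}. -/

import Mathlib

/-- The spectral norm (largest singular value) of a square real matrix,
realized as the operator norm of the induced map on Euclidean space. -/
noncomputable def specNorm {M : ℕ} (Q : Matrix (Fin M) (Fin M) ℝ) : ℝ :=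
  ‖Matrix.toEuclideanCLM (𝕜 := ℝ) Q‖

/-- The set `𝓜(ρ, r)` of `M × M` real matrices with rank at most `r` and
spectral norm at most `ρ`. -/
def lowRankBall (M : ℕ) (ρ : ℝ) (r : ℕ) : Set (Matrix (Fin M) (Fin M) ℝ) :=
  {Q | Q.rank ≤ r ∧ specNorm Q ≤ ρ}

/-- The Frobenius norm `‖Q‖_F = √tr(QQᵀ)`. -/
noncomputable def frobNorm {M : ℕ} (Q : Matrix (Fin M) (Fin M) ℝ) : ℝ :=
  Real.sqrt (Matrix.trace (Q * Q.transpose))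

open Module MeasureTheory Metric Set
open scoped ENNReal Matrix

/-- Volume bound on the cardinality of a `δ`-separated set in a ball of radius `R`. -/
theorem Finset.card_le_of_separated_of_norm_le {E : Type*} [NormedAddCommGroup E]
    [NormedSpace ℝ E] [FiniteDimensional ℝ E] {R δ : ℝ} (hR : 0 ≤ R) (hδ : 0 < δ)
    (s : Finset E) (hs : ∀ c ∈ s, ‖c‖ ≤ R)
    (h : ∀ c ∈ s, ∀ d ∈ s, c ≠ d → δ ≤ ‖c - d‖) :
    (s.card : ℝ) ≤ (1 + 2 * R / δ) ^ finrank ℝ E := by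
  borelize E
  let μ : Measure E := Measure.addHaar
  have hδ2 : 0 < δ / 2 := by positivity
  have hRδ : 0 < R + δ / 2 := by positivity
  have hdisj : (s : Set E).Pairwise (Function.onFun Disjoint fun c => ball c (δ / 2)) := by
    rintro c hc d hd hcd
    apply ball_disjoint_ball
    rw [dist_eq_norm, add_halves]
    exact h c hc d hd hcd
  have hsub : (⋃ c ∈ s, ball c (δ / 2)) ⊆ ball (0 : E) (R + δ / 2) := by
    refine iUnion₂_subset fun x hx => ball_subset_ball' ?_
    rw [dist_zero_right]
    linarith [hs x hx]
  have hvol : (s.card : ℝ≥0∞) * ENNReal.ofReal ((δ / 2) ^ finrank ℝ E) * μ (ball 0 1) ≤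
      ENNReal.ofReal ((R + δ / 2) ^ finrank ℝ E) * μ (ball 0 1) :=
    calc
      _ = μ (⋃ c ∈ s, ball c (δ / 2)) := by
        rw [measure_biUnion_finset hdisj fun c _ => measurableSet_ball]
        simp only [μ.addHaar_ball_of_pos _ hδ2, Finset.sum_const, nsmul_eq_mul, mul_assoc]
      _ ≤ μ (ball (0 : E) (R + δ / 2)) := measure_mono hsub
      _ = _ := by simp only [μ.addHaar_ball_of_pos _ hRδ]
  have hcard := ENNReal.toReal_le_of_le_ofReal (by positivity)
    ((ENNReal.mul_le_mul_iff_left (measure_ball_pos _ _ zero_lt_one).ne'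
      measure_ball_lt_top.ne).1 hvol)
  rw [ENNReal.toReal_mul, ENNReal.toReal_natCast, ENNReal.toReal_ofReal (by positivity),
    ← le_div_iff₀ (by positivity), ← div_pow] at hcard
  convert! hcard using 2
  field_simp
  ring

/-- A closed ball of radius `R` has a `δ`-net, contained in it, of at most
`(1 + 2R/δ)^dim` points. -/
theorem exists_finset_net_closedBall (E : Type*) [NormedAddCommGroup E] [NormedSpace ℝ E]
    [FiniteDimensional ℝ E] {R δ : ℝ} (hR : 0 ≤ R) (hδ : 0 < δ) :
    ∃ s : Finset E, (s.card : ℝ) ≤ (1 + 2 * R / δ) ^ finrank ℝ E ∧ (∀ c ∈ s, ‖c‖ ≤ R) ∧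
      ∀ x : E, ‖x‖ ≤ R → ∃ c ∈ s, ‖x - c‖ ≤ δ := by
  classical
  let P : Finset E → Prop := fun s =>
    (∀ c ∈ s, ‖c‖ ≤ R) ∧ ∀ c ∈ s, ∀ d ∈ s, c ≠ d → δ ≤ ‖c - d‖
  have hcard (s : Finset E) (hs : P s) : (s.card : ℝ) ≤ (1 + 2 * R / δ) ^ finrank ℝ E :=
    s.card_le_of_separated_of_norm_le hR hδ hs.1 hs.2
  have hbdd : BddAbove (Finset.card '' {s | P s}) := by
    refine ⟨⌊(1 + 2 * R / δ) ^ finrank ℝ E⌋₊, ?_⟩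
    rintro _ ⟨s, hs, rfl⟩
    exact Nat.le_floor (hcard s hs)
  obtain ⟨s, hs, hmax⟩ := Nat.sSup_mem (s := Finset.card '' {s | P s})
    ⟨0, ∅, by simp [P], rfl⟩ hbdd
  refine ⟨s, hcard s hs, hs.1, fun x hx => ?_⟩
  by_contra! hfar
  have hxs : x ∉ s := fun hxs => by
    have := hfar x hxs
    simp only [sub_self, norm_zero] at this
    linarith
  have hP : P (insert x s) := by
    refine ⟨by simpa [hx] using hs.1, fun c hc d hd hcd => ?_⟩
    rcases Finset.mem_insert.1 hc with hcx | hc <;> rcases Finset.mem_insert.1 hd with hdx | hd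
    · exact absurd (hcx.trans hdx.symm) hcd
    · exact hcx ▸ (hfar d hd).le
    · exact hdx ▸ (hfar c hc).le.trans_eq (norm_sub_rev _ _)
    · exact hs.2 c hc d hd hcd
  have hle := le_csSup hbdd ⟨insert x s, hP, rfl⟩
  rw [← hmax, Finset.card_insert_of_notMem hxs] at hle
  omega

/-- A subspace of dimension at most `r` has a Parseval frame of `r` vectors of norm at most `1`. -/
theorem Submodule.exists_parseval_frame {E : Type*} [NormedAddCommGroup E]
    [InnerProductSpace ℝ E] [FiniteDimensional ℝ E] (W : Submodule ℝ E) {r : ℕ}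
    (hW : finrank ℝ W ≤ r) :
    ∃ u : Fin r → E, (∀ j, ‖u j‖ ≤ 1) ∧ ∀ x ∈ W, ∑ j, inner ℝ (u j) x • u j = x := by
  obtain ⟨m, rfl⟩ := Nat.exists_eq_add_of_le hW
  let b := stdOrthonormalBasis ℝ W
  refine ⟨Fin.append (fun j => (b j : E)) 0, fun j => ?_, fun x hx => ?_⟩
  · refine Fin.addCases (fun i => ?_) (fun i => ?_) j
    · simp only [Fin.append_left]
      exact (b.norm_eq_one i).le
    · simp
  · have := congrArg (Subtype.val) (b.sum_repr' ⟨x, hx⟩)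
    simpa [Fin.sum_univ_add] using this

section Frobenius

attribute [local instance] Matrix.frobeniusNormedAddCommGroup Matrix.frobeniusNormedSpace

theorem Matrix.frobenius_norm_sq {m n : Type*} [Fintype m] [Fintype n] (A : Matrix m n ℝ) :
    ‖A‖ ^ 2 = ∑ i, ∑ j, A i j ^ 2 := by
  rw [Matrix.frobenius_norm_def, ← Real.sqrt_eq_rpow, Real.sq_sqrt (by positivity)]
  simp

theorem frobNorm_eq_norm {M : ℕ} (A : Matrix (Fin M) (Fin M) ℝ) : frobNorm A = ‖A‖ := by
  rw [frobNorm, Real.sqrt_eq_iff_eq_sq, Matrix.frobenius_norm_sq]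
  · simp [Matrix.trace, Matrix.mul_apply, sq]
  · simp only [Matrix.trace, Matrix.mul_apply, Matrix.diag_apply, Matrix.transpose_apply]
    exact Finset.sum_nonneg fun i _ => Finset.sum_nonneg fun j _ => mul_self_nonneg _
  · exact norm_nonneg A

/-- A matrix of rank at most `r` in the spectral unit ball is a product of two factors through
`ℝ^r` of Frobenius norm at most `√r`. -/
theorem exists_factorization_of_mem_lowRankBall {M r : ℕ} {Q : Matrix (Fin M) (Fin M) ℝ}
    (hQ : Q ∈ lowRankBall M 1 r) :
    ∃ (U : Matrix (Fin M) (Fin r) ℝ) (V : Matrix (Fin r) (Fin M) ℝ),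
      ‖U‖ ≤ √r ∧ ‖V‖ ≤ √r ∧ Q = U * V := by
  obtain ⟨hrank, hnorm⟩ := hQ
  set T := Matrix.toEuclideanCLM (𝕜 := ℝ) Q with hT
  have hTdef : specNorm Q = ‖T‖ := rfl
  have hfin : finrank ℝ (LinearMap.range T.toLinearMap) ≤ r := by
    rw [hT, Matrix.coe_toEuclideanCLM_eq_toEuclideanLin]
    refine le_trans (le_of_eq ?_) hrank
    exact (Matrix.rank_eq_finrank_range_toLin Q (EuclideanSpace.basisFun _ ℝ).toBasis
      (EuclideanSpace.basisFun _ ℝ).toBasis).symm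
  obtain ⟨u, hu, hrec⟩ := Submodule.exists_parseval_frame _ hfin
  let w : Fin r → EuclideanSpace ℝ (Fin M) := fun j => ContinuousLinearMap.adjoint T (u j)
  have hw (j : Fin r) : ‖w j‖ ≤ 1 := by
    refine (ContinuousLinearMap.le_opNorm _ _).trans ?_
    rw [LinearIsometryEquiv.norm_map]
    exact mul_le_one₀ hnorm (norm_nonneg _) (hu j)
  have hsum (v : Fin r → EuclideanSpace ℝ (Fin M)) (hv : ∀ j, ‖v j‖ ≤ 1) :
      ∑ j, ∑ i, v j i ^ 2 ≤ (r : ℝ) := by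
    calc ∑ j, ∑ i, v j i ^ 2 = ∑ j, ‖v j‖ ^ 2 := by simp [EuclideanSpace.norm_sq_eq]
      _ ≤ ∑ _j : Fin r, (1 : ℝ) :=
        Finset.sum_le_sum fun j _ => pow_le_one₀ (norm_nonneg _) (hv j)
      _ = r := by simp
  refine ⟨Matrix.of fun i j => u j i, Matrix.of fun j i => w j i, ?_, ?_, ?_⟩
  · apply Real.le_sqrt_of_sq_le
    rw [Matrix.frobenius_norm_sq, Finset.sum_comm]
    exact hsum u hu
  · apply Real.le_sqrt_of_sq_le
    rw [Matrix.frobenius_norm_sq]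
    exact hsum w hw
  · ext i c
    have hcol : T (EuclideanSpace.single c 1) i = Q i c := by
      rw [hT, Matrix.ofLp_toEuclideanCLM]
      simp
    have hin (j : Fin r) : inner ℝ (u j) (T (EuclideanSpace.single c 1)) = w j c := by
      rw [← ContinuousLinearMap.adjoint_inner_left]
      simp [w, EuclideanSpace.inner_single_right]
    have := congrArg (fun x : EuclideanSpace ℝ (Fin M) => x i)
      (hrec (T (EuclideanSpace.single c 1)) ⟨_, rfl⟩)
    simp only [hin, hcol] at this
    rw [← this]
    simp [Matrix.mul_apply, mul_comm]

/-- Products of nets of two Frobenius balls of radius `√r` form a net of the spectral unit ball of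
matrices of rank at most `r`. -/
theorem exists_finset_net_lowRankBall (M : ℕ) {r : ℕ} (hr : 1 ≤ r) {ε : ℝ} (hε : 0 < ε) :
    ∃ S : Finset (Matrix (Fin M) (Fin M) ℝ),
      (S.card : ℝ) ≤ (1 + 4 * r / ε) ^ (2 * M * r) ∧
      ∀ Q ∈ lowRankBall M 1 r, ∃ B ∈ S, frobNorm (Q - B) ≤ ε := by
  classical
  have hr0 : (0 : ℝ) < r := by exact_mod_cast hr
  have hsqrt : 0 < √(r : ℝ) := Real.sqrt_pos.2 hr0
  have hsq : √(r : ℝ) * √(r : ℝ) = r := Real.mul_self_sqrt hr0.le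
  have hδ : 0 < ε / (2 * √(r : ℝ)) := by positivity
  have hbase : 1 + 2 * √(r : ℝ) / (ε / (2 * √(r : ℝ))) = 1 + 4 * r / ε := by
    rw [div_div_eq_mul_div, mul_mul_mul_comm, hsq]
    norm_num
  obtain ⟨A, hAcard, -, hA⟩ :=
    exists_finset_net_closedBall (Matrix (Fin M) (Fin r) ℝ) hsqrt.le hδ
  obtain ⟨B, hBcard, hBR, hB⟩ :=
    exists_finset_net_closedBall (Matrix (Fin r) (Fin M) ℝ) hsqrt.le hδ
  rw [hbase, Module.finrank_matrix] at hAcard hBcard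
  simp only [Fintype.card_fin, Module.finrank_self, mul_one] at hAcard hBcard
  refine ⟨Finset.image₂ (· * ·) A B, ?_, fun Q hQ => ?_⟩
  · calc ((Finset.image₂ (· * ·) A B).card : ℝ) ≤ A.card * B.card := by
          rw [← Nat.cast_mul]
          exact Nat.cast_le.2 (Finset.card_image₂_le _ A B)
      _ ≤ (1 + 4 * r / ε) ^ (M * r) * (1 + 4 * r / ε) ^ (r * M) := by gcongr
      _ = _ := by rw [← pow_add]; congr 1; ring
  · obtain ⟨U, V, hU, hV, rfl⟩ := exists_factorization_of_mem_lowRankBall hQ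
    obtain ⟨U', hU', hUU'⟩ := hA U hU
    obtain ⟨V', hV', hVV'⟩ := hB V hV
    refine ⟨U' * V', Finset.mem_image₂_of_mem hU' hV', ?_⟩
    rw [frobNorm_eq_norm]
    calc ‖U * V - U' * V'‖ = ‖U * (V - V') + (U - U') * V'‖ := by
          rw [Matrix.mul_sub, Matrix.sub_mul, sub_add_sub_cancel]
      _ ≤ ‖U‖ * ‖V - V'‖ + ‖U - U'‖ * ‖V'‖ :=
        (norm_add_le _ _).trans
          (add_le_add (Matrix.frobenius_norm_mul _ _) (Matrix.frobenius_norm_mul _ _))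
      _ ≤ √r * (ε / (2 * √r)) + ε / (2 * √r) * √r := by
        gcongr
        exact hBR V' hV'
      _ = ε := by field_simp; ring

end Frobenius

/-- Covering-number bound for `𝓜(ρ, r)` in the Frobenius metric:
`N(ε, 𝓜(ρ, r)) ≤ (9r/ε)^{4Mr}` whenever `r/ε ≥ 1`. -/
theorem statement10 (M : ℕ) (hM : 1 ≤ M) (r : ℕ) (hr1 : 1 ≤ r) (hrM : r ≤ M)
    (ρ : ℝ) (hρ0 : 0 < ρ) (hρ1 : ρ ≤ 1) (ε : ℝ) (hε : 0 < ε) (hrε : (r : ℝ) / ε ≥ 1) :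
    ∃ S : Finset (Matrix (Fin M) (Fin M) ℝ),
      (S.card : ℝ) ≤ (9 * r / ε) ^ (4 * M * r) ∧
      ∀ Q ∈ lowRankBall M ρ r, ∃ B ∈ S, frobNorm (Q - B) ≤ ε := by
  obtain ⟨S, hcard, hS⟩ := exists_finset_net_lowRankBall M hr1 hε
  refine ⟨S, hcard.trans ?_, fun Q hQ => hS Q ⟨hQ.1, hQ.2.trans hρ1⟩⟩
  have hbase : 1 + 4 * (r : ℝ) / ε ≤ 9 * r / ε := by
    rw [mul_div_assoc, mul_div_assoc]
    linarith
  have hone : 1 ≤ 9 * (r : ℝ) / ε := by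
    rw [mul_div_assoc]
    linarith
  calc (1 + 4 * (r : ℝ) / ε) ^ (2 * M * r) ≤ (9 * r / ε) ^ (2 * M * r) := by gcongr
    _ ≤ (9 * r / ε) ^ (4 * M * r) := pow_le_pow_right₀ hone (by gcongr; norm_num)
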